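/- Suppose s = C(α+1, 2) and X has the generic Hilbert function, i.e. dim_k R_i − dim_k (I_X)_i = min{C(i+2,2), s} for all i ≥ 0, where α := α(I_X). If there exists a homogeneous polynomial F ∈ R with I_X^{(2)} = I_X^2 + ⟨F⟩ and I_X^{(2)} ≠ I_X^2 (i.e. sdefect(I_X,2) = 1), then X is a linear star configuration: there exist linear forms L_1,…,L_r ∈ R, any three of which are linearly independent, such that I_X = ⋂_{1 ≤ i < j ≤ r} ⟨L_i, L_j⟩. -/

import Mathlib

open MvPolynomial

/-- The homogeneous ideal of the point of `ℙ²` represented by `v ∈ k³`: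
the ideal generated by all linear forms vanishing at `v`. -/
noncomputable def pointIdeal {k : Type*} [Field k] (v : Fin 3 → k) :
    Ideal (MvPolynomial (Fin 3) k) :=
  Ideal.span {f | f.IsHomogeneous 1 ∧ MvPolynomial.eval v f = 0}

/-- The ideal `I_X = ⋂ᵢ I_{vᵢ}` of the set of points represented by `v`. -/
noncomputable def pointsIdeal {k : Type*} [Field k] {s : ℕ} (v : Fin s → (Fin 3 → k)) :
    Ideal (MvPolynomial (Fin 3) k) :=
  ⨅ i, pointIdeal (v i)

/-- The `m`-th symbolic power `I_X^{(m)} = ⋂ᵢ I_{vᵢ}^m`. -/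
noncomputable def pointsSymb {k : Type*} [Field k] {s : ℕ} (v : Fin s → (Fin 3 → k)) (m : ℕ) :
    Ideal (MvPolynomial (Fin 3) k) :=
  ⨅ i, (pointIdeal (v i)) ^ m

/-- The degree-`t` graded component of an ideal of `k[x₀,x₁,x₂]`, as a `k`-subspace. -/
noncomputable def gradedPiece {k : Type*} [Field k]
    (I : Ideal (MvPolynomial (Fin 3) k)) (t : ℕ) :
    Submodule k (MvPolynomial (Fin 3) k) :=
  Submodule.restrictScalars k I ⊓ MvPolynomial.homogeneousSubmodule (Fin 3) k t

namespace MvPolynomial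

section Grading

variable {σ R : Type*} [CommRing R]

/-- The map `p ↦ p(T x)`, whose coefficients in `T` are the homogeneous components of `p`. -/
noncomputable def scaleHom (σ R : Type*) [CommRing R] :
    MvPolynomial σ R →ₐ[R] Polynomial (MvPolynomial σ R) :=
  aeval fun i => Polynomial.C (X i) * Polynomial.X

lemma scaleHom_monomial (d : σ →₀ ℕ) (r : R) :
    scaleHom σ R (monomial d r) = Polynomial.monomial d.degree (monomial d r) := by
  rw [scaleHom, aeval_monomial, monomial_eq, ← Polynomial.C_mul_X_pow_eq_monomial]
  simp only [mul_pow, Finsupp.prod, Finset.prod_mul_distrib, Finset.prod_pow_eq_pow_sum, map_mul,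
    map_prod, map_pow, Finsupp.degree]
  rw [← mul_assoc]
  rfl

lemma coeff_scaleHom (p : MvPolynomial σ R) (n : ℕ) :
    (scaleHom σ R p).coeff n = homogeneousComponent n p := by
  induction p using MvPolynomial.induction_on' with
  | monomial d c =>
    rw [scaleHom_monomial, homogeneousComponent_of_mem (isHomogeneous_monomial c rfl),
      Polynomial.coeff_monomial]
    simp [eq_comm]
  | add p q hp hq => simp [map_add, hp, hq]

lemma IsHomogeneous.scaleHom_eq {p : MvPolynomial σ R} {n : ℕ} (hp : p.IsHomogeneous n) :
    scaleHom σ R p = Polynomial.C p * Polynomial.X ^ n := by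
  ext1 m
  rw [coeff_scaleHom, homogeneousComponent_of_mem hp, Polynomial.coeff_C_mul_X_pow]

lemma IsHomogeneous.homogeneousComponent_mul {p : MvPolynomial σ R} {n : ℕ}
    (hp : p.IsHomogeneous n) (q : MvPolynomial σ R) (m : ℕ) :
    homogeneousComponent m (p * q) =
      p * if n ≤ m then homogeneousComponent (m - n) q else 0 := by
  rw [← coeff_scaleHom, map_mul, hp.scaleHom_eq, mul_assoc, Polynomial.coeff_C_mul,
    Polynomial.coeff_X_pow_mul']
  simp only [coeff_scaleHom]

lemma scaleHom_ne_zero {p : MvPolynomial σ R} (hp : p ≠ 0) : scaleHom σ R p ≠ 0 := by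
  contrapose! hp
  rw [← sum_homogeneousComponent p]
  refine Finset.sum_eq_zero fun i _ => ?_
  rw [← coeff_scaleHom, hp, Polynomial.coeff_zero]

lemma IsHomogeneous.of_mul_left [IsDomain R] {p q : MvPolynomial σ R} {n : ℕ}
    (h : (p * q).IsHomogeneous n) (h0 : p * q ≠ 0) : p.IsHomogeneous p.totalDegree := by
  have hp : scaleHom σ R p ≠ 0 := scaleHom_ne_zero (left_ne_zero_of_mul h0)
  have hq : scaleHom σ R q ≠ 0 := scaleHom_ne_zero (right_ne_zero_of_mul h0)
  have he := h.scaleHom_eq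
  rw [map_mul] at he
  have h1 := congrArg Polynomial.natDegree he
  have h2 := congrArg Polynomial.natTrailingDegree he
  rw [Polynomial.natDegree_mul hp hq, Polynomial.natDegree_C_mul_X_pow _ _ h0] at h1
  rw [Polynomial.natTrailingDegree_mul hp hq, Polynomial.C_mul_X_pow_eq_monomial,
    Polynomial.natTrailingDegree_monomial h0] at h2
  have h3 := Polynomial.natTrailingDegree_le_natDegree (scaleHom σ R p)
  have h4 := Polynomial.natTrailingDegree_le_natDegree (scaleHom σ R q)
  have key : p.IsHomogeneous (scaleHom σ R p).natDegree := by
    have : homogeneousComponent (scaleHom σ R p).natDegree p = p := by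
      conv_rhs => rw [← sum_homogeneousComponent p]
      have hne : homogeneousComponent (scaleHom σ R p).natDegree p ≠ 0 := by
        rw [← coeff_scaleHom]
        exact Polynomial.leadingCoeff_ne_zero.2 hp
      rw [Finset.sum_eq_single (scaleHom σ R p).natDegree]
      · intro i _ hi
        rw [← coeff_scaleHom]
        rcases lt_or_gt_of_ne hi with hi | hi
        · exact Polynomial.coeff_eq_zero_of_lt_natTrailingDegree (by omega)
        · exact Polynomial.coeff_eq_zero_of_natDegree_lt hi
      · intro hi
        exact homogeneousComponent_eq_zero _ _ (by simpa using hi)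
    have hk := homogeneousComponent_isHomogeneous (scaleHom σ R p).natDegree p
    rwa [this] at hk
  rwa [key.totalDegree (left_ne_zero_of_mul h0)]

lemma IsHomogeneous.of_dvd [IsDomain R] {p q : MvPolynomial σ R} {n : ℕ}
    (hq : q.IsHomogeneous n) (h0 : q ≠ 0) (h : p ∣ q) : p.IsHomogeneous p.totalDegree := by
  obtain ⟨c, rfl⟩ := h
  exact hq.of_mul_left h0

lemma exists_eq_C_of_mul_totalDegree_le {K : Type*} [Field K] {p q : MvPolynomial σ K}
    (h0 : p * q ≠ 0) (h : (p * q).totalDegree ≤ p.totalDegree) : ∃ c : K, c ≠ 0 ∧ q = C c := by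
  rw [totalDegree_mul_of_isDomain (left_ne_zero_of_mul h0) (right_ne_zero_of_mul h0)] at h
  have hq : q = C (coeff 0 q) := totalDegree_eq_zero_iff_eq_C.1 (by omega)
  refine ⟨_, fun hc => right_ne_zero_of_mul h0 ?_, hq⟩
  rw [hq, hc, C_0]

lemma finrank_homogeneousSubmodule (K : Type*) [Field K] (n : ℕ) :
    Module.finrank K (homogeneousSubmodule (Fin 3) K n) = (n + 2).choose 2 := by
  classical
  rw [homogeneousSubmodule_eq_finsupp_supported]
  have hS : {d : Fin 3 →₀ ℕ | d.degree = n} =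
      ↑((Finset.univ : Finset (Fin 3)).finsuppAntidiag n) := by
    ext d
    simp [Finsupp.degree_eq_sum]
  rw [(AddMonoidAlgebra.supportedEquivFinsupp _).finrank_eq, hS, Module.finrank_finsupp_self]
  simp only [Finset.coe_sort_coe, Fintype.card_coe, Finset.card_finsuppAntidiag_nat_eq_choose]
  simp only [Finset.card_univ, Fintype.card_fin]
  rw [show 3 + n - 1 = n + 2 by omega, Nat.choose_symm_add]

end Grading

end MvPolynomial

section PointIdeal

variable {k : Type*} [Field k] {v : Fin 3 → k}

lemma aeval_C_mul_of_isHomogeneous (v : Fin 3 → k) (l : MvPolynomial (Fin 3) k)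
    {p : MvPolynomial (Fin 3) k} {n : ℕ} (hp : p.IsHomogeneous n) :
    aeval (fun i => C (v i) * l) p = C (eval v p) * l ^ n := by
  have h : (aeval (fun i => C (v i) * l) : MvPolynomial (Fin 3) k →ₐ[k] _).toRingHom =
      (Polynomial.eval₂RingHom (C.comp (eval v)) l).comp (scaleHom (Fin 3) k).toRingHom := by
    apply MvPolynomial.ringHom_ext
    · intro r
      simp [← algebraMap_eq]
      rfl
    · intro i
      simp [scaleHom]
  have h' := congrArg (fun f => f p) h
  simp only [RingHom.comp_apply] at h'
  refine h'.trans ?_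
  change Polynomial.eval₂RingHom (C.comp (eval v)) l (scaleHom (Fin 3) k p) = _
  rw [hp.scaleHom_eq]
  simp

lemma eval_eq_zero_of_mem_pointIdeal {p : MvPolynomial (Fin 3) k} (hp : p ∈ pointIdeal v) :
    eval v p = 0 := by
  have : pointIdeal v ≤ RingHom.ker (eval v) := Ideal.span_le.2 fun f hf => hf.2
  exact this hp

lemma eval_pderiv_eq_zero_of_mem_pointIdeal_sq {p : MvPolynomial (Fin 3) k}
    (hp : p ∈ pointIdeal v ^ 2) (i : Fin 3) : eval v (pderiv i p) = 0 := by
  rw [pow_two] at hp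
  refine Submodule.mul_induction_on hp (fun a ha b hb => ?_) fun a b ha hb => ?_
  · simp [Derivation.leibniz, eval_eq_zero_of_mem_pointIdeal ha, eval_eq_zero_of_mem_pointIdeal hb]
  · simp [ha, hb]

/-- First-order Taylor expansion along the line spanned by `v`. -/
lemma taylor_mem_pointIdeal_sq {l : MvPolynomial (Fin 3) k} (hl : l.IsHomogeneous 1)
    (hl1 : eval v l = 1) (p : MvPolynomial (Fin 3) k) :
    p - aeval (fun i => C (v i) * l) p -
      ∑ i, (X i - C (v i) * l) * aeval (fun i => C (v i) * l) (pderiv i p) ∈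
        pointIdeal v ^ 2 := by
  have hm (i : Fin 3) : X i - C (v i) * l ∈ pointIdeal v :=
    Ideal.subset_span ⟨(isHomogeneous_X k i).sub (hl.C_mul _), by simp [hl1]⟩
  induction p using MvPolynomial.induction_on with
  | C a => simp [algebraMap_eq]
  | add p q hp hq =>
    convert add_mem hp hq using 1
    simp only [map_add, mul_add, Finset.sum_add_distrib]
    ring
  | mul_X p j hp =>
    set S := ∑ i, (X i - C (v i) * l) * aeval (fun i => C (v i) * l) (pderiv i p) with hS
    have hSm : S * (X j - C (v j) * l) ∈ pointIdeal v ^ 2 := by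
      rw [pow_two]
      exact Ideal.mul_mem_mul (Ideal.sum_mem _ fun i _ => Ideal.mul_mem_right _ _ (hm i)) (hm j)
    have hsum : ∑ i, (X i - C (v i) * l) * aeval (fun i => C (v i) * l) (pderiv i (p * X j)) =
        (X j - C (v j) * l) * aeval (fun i => C (v i) * l) p + C (v j) * l * S := by
      rw [hS, Finset.mul_sum, ← Finset.sum_ite_eq' Finset.univ j
        (fun i => (X i - C (v i) * l) * aeval (fun i => C (v i) * l) p)
        |>.trans (if_pos (Finset.mem_univ j)),
        ← Finset.sum_add_distrib]
      refine Finset.sum_congr rfl fun i _ => ?_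
      by_cases hij : i = j
      · subst hij
        simp [Derivation.leibniz]
        ring
      · simp [Derivation.leibniz, pderiv_X_of_ne (Ne.symm hij), hij]
        ring
    rw [hsum]
    convert add_mem (Ideal.mul_mem_right (X j) _ hp) hSm using 1
    simp only [map_mul, aeval_X]
    ring

lemma exists_isHomogeneous_one_eval_eq_one (hv : v ≠ 0) :
    ∃ l : MvPolynomial (Fin 3) k, l.IsHomogeneous 1 ∧ eval v l = 1 := by
  obtain ⟨i, hi⟩ := Function.ne_iff.1 hv
  exact ⟨C (v i)⁻¹ * X i, isHomogeneous_C_mul_X _ _, by simpa using inv_mul_cancel₀ hi⟩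

lemma mem_pointIdeal_iff (hv : v ≠ 0) {p : MvPolynomial (Fin 3) k} {n : ℕ}
    (hp : p.IsHomogeneous n) : p ∈ pointIdeal v ↔ eval v p = 0 := by
  refine ⟨eval_eq_zero_of_mem_pointIdeal, fun h => ?_⟩
  obtain ⟨l, hl, hl1⟩ := exists_isHomogeneous_one_eval_eq_one hv
  have ht := Ideal.pow_le_self two_ne_zero (taylor_mem_pointIdeal_sq hl hl1 p)
  rw [aeval_C_mul_of_isHomogeneous v l hp, h, C_0, zero_mul, sub_zero] at ht
  refine (Submodule.sub_mem_iff_left _ (Ideal.sum_mem _ fun i _ => Ideal.mul_mem_right _ _ ?_)).1 ht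
  exact Ideal.subset_span ⟨(isHomogeneous_X k i).sub (hl.C_mul _), by simp [hl1]⟩

lemma mem_pointIdeal_sq_iff (hv : v ≠ 0) {p : MvPolynomial (Fin 3) k} {n : ℕ}
    (hp : p.IsHomogeneous n) :
    p ∈ pointIdeal v ^ 2 ↔ eval v p = 0 ∧ ∀ i, eval v (pderiv i p) = 0 := by
  refine ⟨fun h => ⟨eval_eq_zero_of_mem_pointIdeal (Ideal.pow_le_self two_ne_zero h),
    eval_pderiv_eq_zero_of_mem_pointIdeal_sq h⟩, fun ⟨h, h'⟩ => ?_⟩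
  obtain ⟨l, hl, hl1⟩ := exists_isHomogeneous_one_eval_eq_one hv
  have ht := taylor_mem_pointIdeal_sq hl hl1 p
  rw [aeval_C_mul_of_isHomogeneous v l hp, h, C_0, zero_mul, sub_zero] at ht
  rwa [Finset.sum_eq_zero, sub_zero] at ht
  intro i _
  rw [aeval_C_mul_of_isHomogeneous v l hp.pderiv, h', C_0, zero_mul, mul_zero]

lemma mem_pointIdeal_sq_of_mul_mem (hv : v ≠ 0) {p q : MvPolynomial (Fin 3) k} {n : ℕ}
    (hq : q.IsHomogeneous n) (h : p * q ∈ pointIdeal v ^ 2) (hp : eval v p ≠ 0) :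
    q ∈ pointIdeal v ^ 2 := by
  have h1 := eval_eq_zero_of_mem_pointIdeal (Ideal.pow_le_self two_ne_zero h)
  rw [map_mul, mul_eq_zero, or_iff_right hp] at h1
  refine (mem_pointIdeal_sq_iff hv hq).2 ⟨h1, fun i => ?_⟩
  have h2 := eval_pderiv_eq_zero_of_mem_pointIdeal_sq h i
  simpa [Derivation.leibniz, h1, hp] using h2

lemma eq_zero_of_mem_pointIdeal_sq {l : MvPolynomial (Fin 3) k} (hl : l.IsHomogeneous 1)
    (h : l ∈ pointIdeal v ^ 2) : l = 0 := by
  have hle : pointIdeal v ≤ idealOfVars (Fin 3) k := Ideal.span_le.2 fun f hf => by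
    have := (mem_pow_idealOfVars_iff' 1 f).2 fun x hx => hf.1.coeff_eq_zero (by omega)
    rwa [pow_one] at this
  have h2 := (mem_pow_idealOfVars_iff' 2 l).1 (Ideal.pow_right_mono hle 2 h)
  ext d
  by_cases hd : d.degree = 1
  · simpa using h2 d (by omega)
  · simpa using hl.coeff_eq_zero hd

end PointIdeal

section Forms

variable {k : Type*} [Field k]

instance (n : ℕ) : FiniteDimensional k (homogeneousSubmodule (Fin 3) k n) :=
  Module.Finite.iff_fg.2 (homogeneousSubmodule_fg _ _ n)

/-- Evaluation of forms of degree `n` at a family of vectors. -/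
noncomputable def evalForms {ι : Type*} (w : ι → Fin 3 → k) (n : ℕ) :
    homogeneousSubmodule (Fin 3) k n →ₗ[k] ι → k :=
  LinearMap.pi fun i => (aeval (w i)).toLinearMap ∘ₗ Submodule.subtype _

lemma evalForms_apply {ι : Type*} (w : ι → Fin 3 → k) (n : ℕ)
    (f : homogeneousSubmodule (Fin 3) k n) (i : ι) :
    evalForms w n f i = eval (w i) (f : MvPolynomial (Fin 3) k) := by
  simp [evalForms, aeval_eq_eval]

lemma exists_linear_form_through (v w : Fin 3 → k) :
    ∃ l : MvPolynomial (Fin 3) k, l.IsHomogeneous 1 ∧ l ≠ 0 ∧ eval v l = 0 ∧ eval w l = 0 := by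
  have h : LinearMap.ker (evalForms ![v, w] 1) ≠ ⊥ :=
    LinearMap.ker_ne_bot_of_finrank_lt (by simp [finrank_homogeneousSubmodule])
  obtain ⟨l, hl, hl0⟩ := Submodule.exists_mem_ne_zero_of_ne_bot h
  refine ⟨l, l.2, by simpa using hl0, ?_, ?_⟩
  · simpa [evalForms_apply] using congrFun hl 0
  · simpa [evalForms_apply] using congrFun hl 1

lemma exists_linear_form_separating {v w : Fin 3 → k} (h : LinearIndependent k ![v, w]) :
    ∃ l : MvPolynomial (Fin 3) k, l.IsHomogeneous 1 ∧ eval v l = 0 ∧ eval w l ≠ 0 := by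
  have hw : w ∉ Submodule.span k {v} := by
    rw [Submodule.mem_span_singleton]
    rintro ⟨a, ha⟩
    have := LinearIndependent.pair_iff.1 h a (-1) (by simp [ha])
    simp at this
  obtain ⟨f, hf, hv⟩ := Submodule.exists_le_ker_of_notMem hw
  have he (u : Fin 3 → k) : eval u (∑ i, C (f (Pi.single i 1)) * X i) = f u := by
    rw [LinearMap.pi_apply_eq_sum_univ f u]
    simp only [map_sum, map_mul, eval_C, eval_X, smul_eq_mul]
    refine Finset.sum_congr rfl fun i _ => ?_
    rw [mul_comm]
    congr 2
    ext j
    simp [Pi.single_apply, eq_comm]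
  refine ⟨∑ i, C (f (Pi.single i 1)) * X i,
    IsHomogeneous.sum _ _ _ fun i _ => isHomogeneous_C_mul_X _ _, ?_, ?_⟩
  · rw [he]
    exact hv (Submodule.mem_span_singleton_self v)
  · rwa [he]

lemma pointIdeal_eq_span_pair {v : Fin 3 → k} (hv : v ≠ 0) {l m : MvPolynomial (Fin 3) k}
    (hl : l.IsHomogeneous 1) (hm : m.IsHomogeneous 1) (hlm : LinearIndependent k ![l, m])
    (hlv : eval v l = 0) (hmv : eval v m = 0) : pointIdeal v = Ideal.span {l, m} := by
  apply le_antisymm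
  · refine Ideal.span_le.2 fun f ⟨hf, hfv⟩ => ?_
    have hmem : f ∈ Submodule.span k (Set.range ![l, m]) := by
      by_contra hcon
      have hind : LinearIndependent k ![f, l, m] := linearIndependent_finCons.2 ⟨hlm, hcon⟩
      have hrank := finrank_span_eq_card hind
      set W := homogeneousSubmodule (Fin 3) k 1 ⊓ LinearMap.ker (aeval v).toLinearMap with hW
      have hlt : W < homogeneousSubmodule (Fin 3) k 1 := by
        refine lt_of_le_of_ne inf_le_left fun he => ?_
        obtain ⟨q, hq, hq1⟩ := exists_isHomogeneous_one_eval_eq_one hv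
        have : q ∈ W := he ▸ hq
        have h0 : eval v q = 0 := by simpa [aeval_eq_eval] using this.2
        simp [h0] at hq1
      have hle : Submodule.span k (Set.range ![f, l, m]) ≤ W := by
        rw [Submodule.span_le]
        rintro _ ⟨i, rfl⟩
        fin_cases i
        · exact ⟨hf, by simpa [aeval_eq_eval] using hfv⟩
        · exact ⟨hl, by simpa [aeval_eq_eval] using hlv⟩
        · exact ⟨hm, by simpa [aeval_eq_eval] using hmv⟩
      have h1 := Submodule.finrank_lt_finrank_of_lt hlt
      have : FiniteDimensional k W := Submodule.finiteDimensional_of_le hlt.le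
      have h2 := Submodule.finrank_mono hle
      rw [finrank_homogeneousSubmodule] at h1
      simp at hrank
      norm_num [Nat.choose] at h1
      omega
    have hle : Submodule.span k (Set.range ![l, m]) ≤
        (Ideal.span {l, m}).restrictScalars k := by
      rw [Submodule.span_le]
      rintro _ ⟨i, rfl⟩
      fin_cases i
      · exact Ideal.subset_span (by simp)
      · exact Ideal.subset_span (by simp)
    exact hle hmem
  · rw [Ideal.span_le, Set.insert_subset_iff, Set.singleton_subset_iff]
    exact ⟨Ideal.subset_span ⟨hl, hlv⟩, Ideal.subset_span ⟨hm, hmv⟩⟩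

/-- An irreducible divisor of a nonzero linear form is a linear form. -/
lemma isHomogeneous_one_of_irreducible_of_dvd {l a : MvPolynomial (Fin 3) k}
    (hl : l.IsHomogeneous 1) (hl0 : l ≠ 0) (ha : Irreducible a) (h : a ∣ l) :
    a.IsHomogeneous 1 := by
  have hh := hl.of_dvd hl0 h
  have hle : a.totalDegree ≤ 1 := by
    rw [← hl.totalDegree hl0]
    exact totalDegree_le_of_dvd_of_isDomain h hl0
  have hne : a.totalDegree ≠ 0 := fun h0 => by
    have hc := totalDegree_eq_zero_iff_eq_C.1 h0
    refine ha.not_isUnit (hc ▸ (IsUnit.map C (isUnit_iff_ne_zero.2 fun h00 => ha.ne_zero ?_)))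
    rw [hc, h00, C_0]
  rwa [show a.totalDegree = 1 by omega] at hh

end Forms

section SymbolicSquare

variable {k : Type*} [Field k] {s : ℕ} {v : Fin s → Fin 3 → k}

lemma mem_pointsIdeal_iff (hv0 : ∀ i, v i ≠ 0) {f : MvPolynomial (Fin 3) k} {n : ℕ}
    (hf : f.IsHomogeneous n) : f ∈ pointsIdeal v ↔ ∀ i, eval (v i) f = 0 := by
  simp only [pointsIdeal, Ideal.mem_iInf, mem_pointIdeal_iff (hv0 _) hf]

lemma mem_pointsSymb_iff {f : MvPolynomial (Fin 3) k} {m : ℕ} :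
    f ∈ pointsSymb v m ↔ ∀ i, f ∈ pointIdeal (v i) ^ m := by
  simp only [pointsSymb, Ideal.mem_iInf]

section

attribute [local instance] MvPolynomial.gradedAlgebra

lemma pointsIdeal_isHomogeneous (v : Fin s → Fin 3 → k) :
    (pointsIdeal v).IsHomogeneous (homogeneousSubmodule (Fin 3) k) :=
  Ideal.IsHomogeneous.iInf fun _ => Ideal.homogeneous_span _ _ fun _ hf => ⟨1, hf.1⟩

end

lemma pointsIdeal_le_pow_idealOfVars (hv0 : ∀ i, v i ≠ 0) {α : ℕ}
    (hmin : ∀ t < α, ∀ f : MvPolynomial (Fin 3) k, f.IsHomogeneous t →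
      (∀ i, eval (v i) f = 0) → f = 0) :
    pointsIdeal v ≤ idealOfVars (Fin 3) k ^ α := by
  intro f hf
  refine (mem_pow_idealOfVars_iff' α f).2 fun d hd => ?_
  have hh := homogeneousComponent_isHomogeneous d.degree f
  have h0 := hmin _ hd _ hh ((mem_pointsIdeal_iff hv0 hh).1
    (homogeneousComponent_mem_of_mem (pointsIdeal_isHomogeneous v) hf _))
  simpa [coeff_homogeneousComponent] using congrArg (coeff d) h0

lemma dvd_of_mem_pointsSymb (hv0 : ∀ i, v i ≠ 0) {α d : ℕ}
    (hmin : ∀ t < α, ∀ f : MvPolynomial (Fin 3) k, f.IsHomogeneous t →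
      (∀ i, eval (v i) f = 0) → f = 0)
    {F : MvPolynomial (Fin 3) k} (hF : F.IsHomogeneous d)
    (hsymb : pointsSymb v 2 = pointsIdeal v ^ 2 + Ideal.span {F})
    {t : ℕ} (ht : t < 2 * α) {f : MvPolynomial (Fin 3) k} (hf : f.IsHomogeneous t)
    (hfm : f ∈ pointsSymb v 2) : F ∣ f := by
  rw [hsymb, Ideal.add_eq_sup] at hfm
  obtain ⟨g, hg, e, he, rfl⟩ := Submodule.mem_sup.1 hfm
  obtain ⟨h, rfl⟩ := Ideal.mem_span_singleton.1 he
  have hg' := Ideal.pow_right_mono (pointsIdeal_le_pow_idealOfVars hv0 hmin) 2 hg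
  rw [← pow_mul, mem_pow_idealOfVars_iff'] at hg'
  have hg0 : homogeneousComponent t g = 0 := by
    ext x
    rw [coeff_homogeneousComponent]
    split_ifs with hx
    · simpa using hg' x (by omega)
    · simp
  rw [← homogeneousComponent_eq_self hf, map_add, hg0, zero_add, hF.homogeneousComponent_mul]
  exact dvd_mul_right _ _

lemma exists_separator {α : ℕ} (hα : 1 ≤ α) (hcard : s = (α + 1).choose 2)
    (hmin : ∀ t < α, ∀ f : MvPolynomial (Fin 3) k, f.IsHomogeneous t →
      (∀ i, eval (v i) f = 0) → f = 0) (P : Fin s) :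
    ∃ G : MvPolynomial (Fin 3) k, G.IsHomogeneous (α - 1) ∧ eval (v P) G ≠ 0 ∧
      ∀ Q, Q ≠ P → eval (v Q) G = 0 := by
  have hinj : Function.Injective (evalForms v (α - 1)) := by
    rw [← LinearMap.ker_eq_bot, LinearMap.ker_eq_bot']
    intro f hf
    have := hmin (α - 1) (by omega) f f.2 fun i => by
      rw [← evalForms_apply, hf, Pi.zero_apply]
    simpa using this
  have hrank : Module.finrank k (homogeneousSubmodule (Fin 3) k (α - 1)) =
      Module.finrank k (Fin s → k) := by
    rw [finrank_homogeneousSubmodule, Module.finrank_fin_fun, hcard]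
    congr 1
    omega
  obtain ⟨G, hG⟩ := (LinearMap.injective_iff_surjective_of_finrank_eq_finrank hrank).1 hinj
    (Pi.single P 1)
  refine ⟨G, G.2, ?_, fun Q hQ => ?_⟩
  · rw [← evalForms_apply, hG]
    simp
  · rw [← evalForms_apply, hG]
    simp [hQ]

/-- The partial derivatives of forms of degree `n` evaluated at a family of vectors. -/
noncomputable def evalPartials {ι : Type*} (w : ι → Fin 3 → k) (n : ℕ) :
    homogeneousSubmodule (Fin 3) k n →ₗ[k] ι × Fin 3 → k :=
  LinearMap.pi fun i =>
    (aeval (w i.1)).toLinearMap ∘ₗ (pderiv i.2).toLinearMap ∘ₗ Submodule.subtype _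

lemma evalPartials_apply {ι : Type*} (w : ι → Fin 3 → k) (n : ℕ)
    (f : homogeneousSubmodule (Fin 3) k n) (i : ι × Fin 3) :
    evalPartials w n f i = eval (w i.1) (pderiv i.2 (f : MvPolynomial (Fin 3) k)) := by
  simp [evalPartials, aeval_eq_eval]

lemma mem_pointsSymb_of_evalPartials_eq_zero [CharZero k] (hv0 : ∀ i, v i ≠ 0) {n : ℕ}
    (hn : n ≠ 0) {f : homogeneousSubmodule (Fin 3) k n} (hf : evalPartials v n f = 0) :
    (f : MvPolynomial (Fin 3) k) ∈ pointsSymb v 2 := by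
  have hfh : (f : MvPolynomial (Fin 3) k).IsHomogeneous n := f.2
  have hp (P : Fin s) (i : Fin 3) : eval (v P) (pderiv i (f : MvPolynomial (Fin 3) k)) = 0 := by
    rw [← evalPartials_apply v n f (P, i), hf, Pi.zero_apply]
  refine mem_pointsSymb_iff.2 fun P => (mem_pointIdeal_sq_iff (hv0 P) hfh).2 ⟨?_, hp P⟩
  have he := congrArg (eval (v P)) hfh.sum_X_mul_pderiv
  simpa [hp, hn] using he.symm

lemma degree_le_of_forall_dvd [CharZero k] (hv0 : ∀ i, v i ≠ 0) {α d : ℕ} (hα : 2 ≤ α)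
    (hcard : s = (α + 1).choose 2) (hd : d ≤ 2 * α - 1) {F : MvPolynomial (Fin 3) k}
    (hF : F.IsHomogeneous d)
    (hdvd : ∀ f : MvPolynomial (Fin 3) k, f.IsHomogeneous (2 * α - 1) →
      f ∈ pointsSymb v 2 → F ∣ f) :
    d ≤ α + 1 := by
  have h1 := LinearMap.finrank_range_add_finrank_ker (evalPartials v (2 * α - 1))
  have h2 : Module.finrank k (LinearMap.range (evalPartials v (2 * α - 1))) ≤ 3 * s := by
    refine (Submodule.finrank_le _).trans ?_
    simp [mul_comm]
  set Ψ : homogeneousSubmodule (Fin 3) k (2 * α - 1 - d) →ₗ[k] MvPolynomial (Fin 3) k :=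
    LinearMap.mulLeft k F ∘ₗ Submodule.subtype _ with hΨ
  have hle : (LinearMap.ker (evalPartials v (2 * α - 1))).map (Submodule.subtype _) ≤
      LinearMap.range Ψ := by
    rintro _ ⟨f, hf, rfl⟩
    obtain ⟨g, hg⟩ := hdvd f f.2 (mem_pointsSymb_of_evalPartials_eq_zero hv0 (by omega) hf)
    refine ⟨⟨homogeneousComponent (2 * α - 1 - d) g, homogeneousComponent_mem _ _⟩, ?_⟩
    have hfh : (f : MvPolynomial (Fin 3) k).IsHomogeneous (2 * α - 1) := f.2
    have := hF.homogeneousComponent_mul g (2 * α - 1)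
    rw [← hg, homogeneousComponent_eq_self hfh, if_pos hd] at this
    simpa [hΨ] using this.symm
  have h3 : Module.finrank k (LinearMap.ker (evalPartials v (2 * α - 1))) ≤
      (2 * α - 1 - d + 2).choose 2 := by
    rw [← Submodule.finrank_map_subtype_eq, ← finrank_homogeneousSubmodule k]
    exact (Submodule.finrank_mono hle).trans (LinearMap.finrank_range_le _)
  rw [finrank_homogeneousSubmodule] at h1
  by_contra! hcon
  have h4 : (2 * α - 1 - d + 2).choose 2 ≤ (α - 1).choose 2 := Nat.choose_le_choose _ (by omega)
  have h5 : (2 * α - 1 + 2).choose 2 ≤ 3 * (α + 1).choose 2 + (α - 1).choose 2 := by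
    rw [← hcard]
    omega
  obtain ⟨a, rfl⟩ := Nat.exists_eq_add_of_le hα
  rw [show 2 * (2 + a) - 1 + 2 = 2 * a + 5 by omega, show 2 + a + 1 = a + 3 by omega,
    show 2 + a - 1 = a + 1 by omega] at h5
  have h6 : (((2 * a + 5).choose 2 : ℕ) : ℚ) ≤
      ((3 * (a + 3).choose 2 + (a + 1).choose 2 : ℕ) : ℚ) :=
    Nat.cast_le.2 h5
  push_cast [Nat.cast_choose_two] at h6
  have : (0 : ℚ) ≤ a := Nat.cast_nonneg a
  nlinarith

end SymbolicSquare

section Lines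

variable {k : Type*} [Field k] {s : ℕ} {v : Fin s → Fin 3 → k}

lemma mul_mul_mem_pointsSymb {P Q : Fin s} {p q l : MvPolynomial (Fin 3) k}
    (hv0 : ∀ i, v i ≠ 0) {m n : ℕ} (hp : p.IsHomogeneous m) (hq : q.IsHomogeneous n)
    (hl : l.IsHomogeneous 1) (hpv : ∀ R, R ≠ P → eval (v R) p = 0)
    (hqv : ∀ R, R ≠ Q → eval (v R) q = 0) (hPQ : P ≠ Q)
    (hlP : eval (v P) l = 0) (hlQ : eval (v Q) l = 0) : p * q * l ∈ pointsSymb v 2 := by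
  refine mem_pointsSymb_iff.2 fun R => ?_
  rw [pow_two]
  have hp' (h : R ≠ P) := (mem_pointIdeal_iff (hv0 R) hp).2 (hpv R h)
  have hq' (h : R ≠ Q) := (mem_pointIdeal_iff (hv0 R) hq).2 (hqv R h)
  by_cases hRP : R = P
  · have hl' := (mem_pointIdeal_iff (hv0 R) hl).2 (by rwa [hRP])
    rw [mul_assoc]
    exact Ideal.mul_mem_left _ _ (Ideal.mul_mem_mul (hq' (hRP ▸ hPQ)) hl')
  · by_cases hRQ : R = Q
    · have hl' := (mem_pointIdeal_iff (hv0 R) hl).2 (by rwa [hRQ])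
      rw [mul_right_comm]
      exact Ideal.mul_mem_right _ _ (Ideal.mul_mem_mul (hp' hRP) hl')
    · exact Ideal.mul_mem_right _ _ (Ideal.mul_mem_mul (hp' hRP) (hq' hRQ))

variable {α d : ℕ} {F : MvPolynomial (Fin 3) k} {G : Fin s → MvPolynomial (Fin 3) k}

lemma isHomogeneous_one_of_irreducible_factor (hv0 : ∀ i, v i ≠ 0) (hs : 0 < s)
    (hF : F.IsHomogeneous d) (hF0 : F ≠ 0) (hFs : F ∈ pointsSymb v 2) (hd : d < 2 * α)
    (hdvd : ∀ t < 2 * α, ∀ f : MvPolynomial (Fin 3) k, f.IsHomogeneous t →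
      f ∈ pointsSymb v 2 → F ∣ f)
    (hG0 : ∀ P, eval (v P) (G P) ≠ 0)
    (hGF : ∀ P Q l, P ≠ Q → l.IsHomogeneous 1 → eval (v P) l = 0 → eval (v Q) l = 0 →
      F ∣ G P * G Q * l)
    {a : MvPolynomial (Fin 3) k} (ha : Irreducible a) (haF : a ∣ F) : a.IsHomogeneous 1 := by
  by_contra hcon
  have hnl {l : MvPolynomial (Fin 3) k} (hl : l.IsHomogeneous 1) (hl0 : l ≠ 0) : ¬ a ∣ l :=
    fun h => hcon (isHomogeneous_one_of_irreducible_of_dvd hl hl0 ha h)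
  have key (P Q : Fin s) (hPQ : P ≠ Q) : a ∣ G P ∨ a ∣ G Q := by
    obtain ⟨l, hl, hl0, hlP, hlQ⟩ := exists_linear_form_through (v P) (v Q)
    rcases ha.prime.dvd_or_dvd (haF.trans (hGF P Q l hPQ hl hlP hlQ)) with h | h
    · exact ha.prime.dvd_or_dvd h
    · exact absurd h (hnl hl hl0)
  obtain ⟨P₀, hP₀⟩ : ∃ P₀, ∀ P, P ≠ P₀ → a ∣ G P := by
    by_cases h : ∃ P₀, ¬ a ∣ G P₀
    · obtain ⟨P₀, h⟩ := h
      exact ⟨P₀, fun P hP => (key P P₀ hP).resolve_right h⟩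
    · push Not at h
      exact ⟨⟨0, hs⟩, fun P _ => h P⟩
  have hav (P : Fin s) (hP : P ≠ P₀) : eval (v P) a ≠ 0 := fun h0 => by
    obtain ⟨c, hc⟩ := hP₀ P hP
    exact hG0 P (by rw [hc, map_mul, h0, zero_mul])
  have hah := hF.of_dvd hF0 haF
  obtain ⟨b, rfl⟩ := haF
  have hbh := hF.of_dvd hF0 (dvd_mul_left b a)
  have hdeg := hF.totalDegree hF0
  rw [totalDegree_mul_of_isDomain (left_ne_zero_of_mul hF0) (right_ne_zero_of_mul hF0)] at hdeg
  have ha0 : a.totalDegree ≠ 0 := fun h0 => by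
    obtain ⟨c, hc, rfl⟩ := exists_eq_C_of_mul_totalDegree_le (p := 1) (q := a)
      (by simpa using ha.ne_zero) (by simp [h0])
    exact ha.not_isUnit (IsUnit.map C (isUnit_iff_ne_zero.2 hc))
  have ha1 : a.totalDegree ≠ 1 := fun h1 => hcon (h1 ▸ hah)
  obtain ⟨l, hl, hl0, hlP, -⟩ := exists_linear_form_through (v P₀) (v P₀)
  have hmem : b * l ^ 2 ∈ pointsSymb v 2 := by
    refine mem_pointsSymb_iff.2 fun P => ?_
    by_cases hP : P = P₀
    · exact Ideal.mul_mem_left _ _ (Ideal.pow_mem_pow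
        ((mem_pointIdeal_iff (hv0 P) hl).2 (by rwa [hP])) 2)
    · exact Ideal.mul_mem_right _ _ (mem_pointIdeal_sq_of_mul_mem (hv0 P) hbh
        (mem_pointsSymb_iff.1 hFs P) (hav P hP))
  have hdv := hdvd (b.totalDegree + 1 * 2) (by omega) _ (hbh.mul (hl.pow 2)) hmem
  rw [mul_comm a b, mul_dvd_mul_iff_left (right_ne_zero_of_mul hF0)] at hdv
  exact hnl hl hl0 (ha.prime.dvd_of_dvd_pow hdv)

lemma not_sq_dvd (hv0 : ∀ i, v i ≠ 0) (hα : 2 ≤ α)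
    (hmin : ∀ t < α, ∀ f : MvPolynomial (Fin 3) k, f.IsHomogeneous t →
      (∀ i, eval (v i) f = 0) → f = 0)
    (hF : F.IsHomogeneous d) (hF0 : F ≠ 0) (hFs : F ∈ pointsSymb v 2) (hd : d < 2 * α)
    (hdvd : ∀ t < 2 * α, ∀ f : MvPolynomial (Fin 3) k, f.IsHomogeneous t →
      f ∈ pointsSymb v 2 → F ∣ f)
    (hG : ∀ P, (G P).IsHomogeneous (α - 1)) (hG0 : ∀ P, eval (v P) (G P) ≠ 0)
    (hGv : ∀ P Q, Q ≠ P → eval (v Q) (G P) = 0)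
    (hGF : ∀ P Q l, P ≠ Q → l.IsHomogeneous 1 → eval (v P) l = 0 → eval (v Q) l = 0 →
      F ∣ G P * G Q * l)
    {a : MvPolynomial (Fin 3) k} (ha : Irreducible a) (ha1 : a.IsHomogeneous 1) :
    ¬ a ^ 2 ∣ F := by
  intro haF
  obtain ⟨P, hP⟩ : ∃ P, eval (v P) a = 0 := by
    by_contra! hcon
    obtain ⟨b, hb⟩ := (dvd_pow_self a two_ne_zero).trans haF
    have hb0 : b ≠ 0 := by
      rintro rfl
      simp [hb] at hF0
    have hbh := hF.of_dvd hF0 (Dvd.intro_left a hb.symm)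
    have hdeg := hF.totalDegree hF0
    rw [hb, totalDegree_mul_of_isDomain ha.ne_zero hb0, ha1.totalDegree ha.ne_zero] at hdeg
    have hmem : b ∈ pointsSymb v 2 := mem_pointsSymb_iff.2 fun P =>
      mem_pointIdeal_sq_of_mul_mem (hv0 P) hbh (hb ▸ mem_pointsSymb_iff.1 hFs P) (hcon P)
    have hle := totalDegree_le_of_dvd_of_isDomain (hdvd _ (by omega) b hbh hmem) hb0
    rw [hF.totalDegree hF0] at hle
    omega
  obtain ⟨Q, hQ⟩ : ∃ Q, eval (v Q) a ≠ 0 := by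
    by_contra! hcon
    exact ha.ne_zero (hmin 1 (by omega) a ha1 hcon)
  have hPQ : P ≠ Q := by
    rintro rfl
    exact hQ hP
  obtain ⟨l, hl, hl0, hlP, hlQ⟩ := exists_linear_form_through (v P) (v Q)
  have hal : ¬ a ∣ l := by
    rintro ⟨c, rfl⟩
    obtain ⟨c, hc, rfl⟩ := exists_eq_C_of_mul_totalDegree_le hl0
      (by rw [hl.totalDegree hl0, ha1.totalDegree ha.ne_zero])
    simp [hQ, hc] at hlQ
  have haP : ¬ a ∣ G P := by
    rintro ⟨c, hc⟩
    exact hG0 P (by rw [hc, map_mul, hP, zero_mul])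
  have h1 := ha.prime.pow_dvd_of_dvd_mul_right 2 hal (haF.trans (hGF P Q l hPQ hl hlP hlQ))
  obtain ⟨c, hc⟩ := ha.prime.pow_dvd_of_dvd_mul_left 2 haP h1
  have hGQ : G Q ≠ 0 := fun h => hG0 Q (by rw [h, map_zero])
  have hc0 : c ≠ 0 := by
    rintro rfl
    simp [hc] at hGQ
  obtain ⟨m, hm, hm0, hmQ, -⟩ := exists_linear_form_through (v Q) (v Q)
  have hch := (hG Q).of_dvd hGQ (Dvd.intro_left _ hc.symm)
  have hdeg := (hG Q).totalDegree hGQ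
  rw [hc, totalDegree_mul_of_isDomain (pow_ne_zero 2 ha.ne_zero) hc0,
    (ha1.pow 2).totalDegree (pow_ne_zero 2 ha.ne_zero)] at hdeg
  refine mul_ne_zero (mul_ne_zero ha.ne_zero hc0) hm0
    (hmin (1 + c.totalDegree + 1) (by omega) _ ((ha1.mul hch).mul hm) fun R => ?_)
  by_cases hR : R = Q
  · rw [hR, map_mul, hmQ, mul_zero]
  · have h2 := hGv Q R hR
    rw [hc, map_mul, map_pow, mul_eq_zero, pow_eq_zero_iff two_ne_zero] at h2
    rw [map_mul, map_mul, mul_eq_zero.2 h2, zero_mul]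

end Lines

section Star

variable {k : Type*} [Field k] {s : ℕ} {v : Fin s → Fin 3 → k}

lemma exists_lines {d : ℕ} {F : MvPolynomial (Fin 3) k} (hF : F.IsHomogeneous d) (hF0 : F ≠ 0)
    (hlin : ∀ a, Irreducible a → a ∣ F → a.IsHomogeneous 1)
    (hsq : ∀ a, Irreducible a → a.IsHomogeneous 1 → ¬ a ^ 2 ∣ F) :
    ∃ (r : ℕ) (L : Fin r → MvPolynomial (Fin 3) k), r ≤ d ∧ (∀ i, L i ≠ 0) ∧
      (∀ i, (L i).IsHomogeneous 1) ∧ (∀ i j, i ≠ j → LinearIndependent k ![L i, L j]) ∧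
      F ∣ ∏ i, L i := by
  classical
  set m := UniqueFactorizationMonoid.factors F with hm
  have hprod : ∏ i, m.toList.get i = m.prod := by
    rw [← List.prod_ofFn, List.ofFn_get, Multiset.prod_toList]
  have hassoc : Associated (∏ i, m.toList.get i) F :=
    hprod ▸ UniqueFactorizationMonoid.factors_prod hF0
  have hmem (i) : m.toList.get i ∈ m := Multiset.mem_toList.1 (List.get_mem _ _)
  have hirr (i) : Irreducible (m.toList.get i) :=
    UniqueFactorizationMonoid.irreducible_of_factor _ (hmem i)
  have hhom (i) : (m.toList.get i).IsHomogeneous 1 :=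
    hlin _ (hirr i) (UniqueFactorizationMonoid.dvd_of_mem_factors (hmem i))
  refine ⟨m.toList.length, m.toList.get, ?_, fun i => (hirr i).ne_zero, hhom,
    fun i j hij => ?_, hassoc.symm.dvd⟩
  · have hh := IsHomogeneous.prod Finset.univ m.toList.get (fun _ => 1) fun i _ => hhom i
    have h0 : ∏ i, m.toList.get i ≠ 0 := Finset.prod_ne_zero_iff.2 fun i _ => (hirr i).ne_zero
    have hle := totalDegree_le_of_dvd_of_isDomain hassoc.dvd hF0
    rw [hh.totalDegree h0, hF.totalDegree hF0] at hle
    simpa using hle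
  · refine (LinearIndependent.pair_iff' (hirr i).ne_zero).2 fun c hc => hsq _ (hirr i) (hhom i) ?_
    refine dvd_trans ?_ hassoc.dvd
    have h2 := Finset.prod_dvd_prod_of_subset {i, j} Finset.univ m.toList.get
      (Finset.subset_univ _)
    rw [Finset.prod_pair hij, ← hc, smul_eq_C_mul] at h2
    exact dvd_trans ⟨C c, by ring⟩ h2

lemma star_of_lines (hv0 : ∀ i, v i ≠ 0)
    (hvind : ∀ i j, i ≠ j → LinearIndependent k ![v i, v j]) {r : ℕ}
    {L : Fin r → MvPolynomial (Fin 3) k} (hL0 : ∀ i, L i ≠ 0)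
    (hL : ∀ i, (L i).IsHomogeneous 1)
    (hLind : ∀ i j, i ≠ j → LinearIndependent k ![L i, L j]) (hr : r.choose 2 ≤ s)
    (hprod : ∏ i, L i ∈ pointsSymb v 2) :
    (∀ i j l : Fin r, i ≠ j → i ≠ l → j ≠ l → LinearIndependent k ![L i, L j, L l]) ∧
      pointsIdeal v = ⨅ (i : Fin r) (j : Fin r) (_ : i < j), Ideal.span {L i, L j} := by
  classical
  have hpair (P : Fin s) : ∃ T : Finset (Fin r), T.card = 2 ∧ ∀ i ∈ T, eval (v P) (L i) = 0 := by
    have hP := mem_pointsSymb_iff.1 hprod P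
    have h0 := eval_eq_zero_of_mem_pointIdeal (Ideal.pow_le_self two_ne_zero hP)
    rw [map_prod, Finset.prod_eq_zero_iff] at h0
    obtain ⟨i, -, hi⟩ := h0
    have h1 : eval (v P) (∏ j ∈ Finset.univ.erase i, L j) = 0 := by
      by_contra h
      rw [← Finset.prod_erase_mul _ _ (Finset.mem_univ i)] at hP
      exact hL0 i (eq_zero_of_mem_pointIdeal_sq (hL i)
        (mem_pointIdeal_sq_of_mul_mem (hv0 P) (hL i) hP h))
    rw [map_prod, Finset.prod_eq_zero_iff] at h1
    obtain ⟨j, hj, hj0⟩ := h1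
    refine ⟨{i, j}, Finset.card_pair (Finset.ne_of_mem_erase hj).symm, ?_⟩
    simp [hi, hj0]
  choose φ hφc hφ using hpair
  have hspan {P : Fin s} {i j : Fin r} (hij : i ≠ j) (hi : eval (v P) (L i) = 0)
      (hj : eval (v P) (L j) = 0) : pointIdeal (v P) = Ideal.span {L i, L j} :=
    pointIdeal_eq_span_pair (hv0 P) (hL i) (hL j) (hLind i j hij) hi hj
  have huniq {P Q : Fin s} {i j : Fin r} (hij : i ≠ j) (hi : eval (v P) (L i) = 0)
      (hj : eval (v P) (L j) = 0) (hi' : eval (v Q) (L i) = 0) (hj' : eval (v Q) (L j) = 0) :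
      P = Q := by
    by_contra hPQ
    obtain ⟨l, hl, hlP, hlQ⟩ := exists_linear_form_separating (hvind P Q hPQ)
    refine hlQ (eval_eq_zero_of_mem_pointIdeal ?_)
    rw [hspan hij hi' hj', ← hspan hij hi hj]
    exact Ideal.subset_span ⟨hl, hlP⟩
  have hinj : Function.Injective φ := fun P Q h => by
    obtain ⟨i, j, hij, hT⟩ := Finset.card_eq_two.1 (hφc P)
    have hi : i ∈ φ P := by simp [hT]
    have hj : j ∈ φ P := by simp [hT]
    exact huniq hij (hφ P i hi) (hφ P j hj) (hφ Q i (h ▸ hi)) (hφ Q j (h ▸ hj))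
  have himage : Finset.univ.image φ = Finset.powersetCard 2 Finset.univ := by
    refine Finset.eq_of_subset_of_card_le (fun T hT => ?_) ?_
    · obtain ⟨P, -, rfl⟩ := Finset.mem_image.1 hT
      exact Finset.mem_powersetCard.2 ⟨Finset.subset_univ _, hφc P⟩
    · simpa [Finset.card_image_of_injective _ hinj] using hr
  have hsurj {i j : Fin r} (hij : i ≠ j) : ∃ P, φ P = {i, j} := by
    have : ({i, j} : Finset (Fin r)) ∈ Finset.univ.image φ := by
      rw [himage]
      exact Finset.mem_powersetCard.2 ⟨Finset.subset_univ _, Finset.card_pair hij⟩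
    simpa using this
  have hexists {i j l : Fin r} (hij : i ≠ j) (hil : i ≠ l) (hjl : j ≠ l) :
      ∃ P, eval (v P) (L i) = 0 ∧ eval (v P) (L j) = 0 ∧ eval (v P) (L l) ≠ 0 := by
    obtain ⟨P, hP⟩ := hsurj hij
    obtain ⟨Q, hQ⟩ := hsurj hil
    have hPi := hφ P i (by simp [hP])
    refine ⟨P, hPi, hφ P j (by simp [hP]), fun hPl => ?_⟩
    have hPQ : P = Q := huniq hil hPi hPl (hφ Q i (by simp [hQ])) (hφ Q l (by simp [hQ]))
    have : j ∈ φ Q := by simp [← hPQ, hP]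
    rw [hQ] at this
    simp [hij.symm, hjl] at this
  refine ⟨fun i j l hij hil hjl => ?_, le_antisymm ?_ ?_⟩
  · rw [Fintype.linearIndependent_iff]
    intro g hg
    simp only [Fin.sum_univ_three, Matrix.cons_val] at hg
    obtain ⟨P, hP1, hP2, hP3⟩ := hexists hij hil hjl
    obtain ⟨Q, hQ1, hQ2, hQ3⟩ := hexists hil hij hjl.symm
    obtain ⟨S, hS1, hS2, hS3⟩ := hexists hjl hij.symm hil.symm
    have h1 := congrArg (eval (v P)) hg
    have h2 := congrArg (eval (v Q)) hg
    have h3 := congrArg (eval (v S)) hg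
    simp [smul_eval, hP1, hP2, hP3] at h1
    simp [smul_eval, hQ1, hQ2, hQ3] at h2
    simp [smul_eval, hS1, hS2, hS3] at h3
    intro t
    fin_cases t
    · exact h3
    · exact h2
    · exact h1
  · refine le_iInf fun i => le_iInf fun j => le_iInf fun hij => ?_
    obtain ⟨P, hP⟩ := hsurj hij.ne
    rw [← hspan hij.ne (hφ P i (by simp [hP])) (hφ P j (by simp [hP]))]
    exact iInf_le _ P
  · refine le_iInf fun P => ?_
    obtain ⟨i, j, hij, hT⟩ := Finset.card_eq_two.1 (hφc P)
    have hi := hφ P i (by simp [hT])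
    have hj := hφ P j (by simp [hT])
    rcases hij.lt_or_gt with h | h
    · rw [hspan hij hi hj]
      exact iInf_le_of_le i (iInf_le_of_le j (iInf_le _ h))
    · rw [hspan hij.symm hj hi]
      exact iInf_le_of_le j (iInf_le_of_le i (iInf_le _ h))

end Star

set_option synthInstance.maxHeartbeats 1000000
set_option maxHeartbeats 1000000

theorem points_generic_sdefect_one_implies_star (k : Type*) [Field k] [IsAlgClosed k]
    [CharZero k] (s : ℕ) (hs : 1 ≤ s)
    (v : Fin s → (Fin 3 → k)) (hv0 : ∀ i, v i ≠ 0)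
    (hvind : ∀ i j, i ≠ j → LinearIndependent k ![v i, v j])
    (α : ℕ) (hα : α = sInf {t : ℕ | gradedPiece (pointsIdeal v) t ≠ ⊥})
    (hcard : s = Nat.choose (α + 1) 2)
    (hgen : ∀ i : ℕ, Nat.choose (i + 2) 2 - Module.finrank k (gradedPiece (pointsIdeal v) i) =
      min (Nat.choose (i + 2) 2) s)
    (hsd : ∃ F : MvPolynomial (Fin 3) k, (∃ d, F.IsHomogeneous d) ∧
      pointsSymb v 2 = pointsIdeal v ^ 2 + Ideal.span {F} ∧
      pointsSymb v 2 ≠ pointsIdeal v ^ 2) :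
    ∃ (r : ℕ) (L : Fin r → MvPolynomial (Fin 3) k),
      (∀ i, (L i).IsHomogeneous 1) ∧
      (∀ i j l : Fin r, i ≠ j → i ≠ l → j ≠ l → LinearIndependent k ![L i, L j, L l]) ∧
      pointsIdeal v = ⨅ (i : Fin r) (j : Fin r) (_ : i < j), Ideal.span {L i, L j} := by
  obtain ⟨F, ⟨d, hF⟩, hsymb, hne⟩ := hsd
  have hα2 : 2 ≤ α := by
    by_contra! hcon
    interval_cases α
    · simp at hcard
      omega
    · obtain rfl : s = 1 := by simpa using hcard
      simp [pointsSymb, pointsIdeal] at hne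
  have hs2 : 1 < s := by
    have := Nat.choose_le_choose 2 (show 3 ≤ α + 1 by omega)
    rw [← hcard] at this
    exact lt_of_lt_of_le (by decide) this
  have hmin : ∀ t < α, ∀ f : MvPolynomial (Fin 3) k, f.IsHomogeneous t →
      (∀ i, eval (v i) f = 0) → f = 0 := by
    intro t ht f hf hfv
    rw [hα] at ht
    have hbot := Nat.notMem_of_lt_sInf ht
    simp only [Set.mem_ofPred_eq, not_not] at hbot
    have hmem : f ∈ gradedPiece (pointsIdeal v) t := ⟨(mem_pointsIdeal_iff hv0 hf).2 hfv, hf⟩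
    rwa [hbot, Submodule.mem_bot] at hmem
  have hFs : F ∈ pointsSymb v 2 := by
    rw [hsymb]
    exact Ideal.mem_sup_right (Ideal.mem_span_singleton_self F)
  have hdvd : ∀ t < 2 * α, ∀ f : MvPolynomial (Fin 3) k, f.IsHomogeneous t →
      f ∈ pointsSymb v 2 → F ∣ f :=
    fun t ht f hf hfm => dvd_of_mem_pointsSymb hv0 hmin hF hsymb ht hf hfm
  choose G hG hG0 hGv using exists_separator (v := v) (by omega : 1 ≤ α) hcard hmin
  have hGh {P Q : Fin s} {l : MvPolynomial (Fin 3) k} (hl : l.IsHomogeneous 1) :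
      (G P * G Q * l).IsHomogeneous (2 * α - 1) := by
    have := ((hG P).mul (hG Q)).mul hl
    rwa [show α - 1 + (α - 1) + 1 = 2 * α - 1 by omega] at this
  have hGF : ∀ P Q l, P ≠ Q → l.IsHomogeneous 1 → eval (v P) l = 0 → eval (v Q) l = 0 →
      F ∣ G P * G Q * l := fun P Q l hPQ hl hlP hlQ =>
    hdvd (2 * α - 1) (by omega) _ (hGh hl)
      (mul_mul_mem_pointsSymb hv0 (hG P) (hG Q) hl (hGv P) (hGv Q) hPQ hlP hlQ)
  have hGne (P : Fin s) : G P ≠ 0 := fun h => hG0 P (by rw [h, map_zero])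
  obtain ⟨hF0, hd⟩ : F ≠ 0 ∧ d ≤ 2 * α - 1 := by
    obtain ⟨l, hl, hl0, hlP, hlQ⟩ := exists_linear_form_through (v ⟨0, hs⟩) (v ⟨1, hs2⟩)
    have h := hGF ⟨0, hs⟩ ⟨1, hs2⟩ l (by simp) hl hlP hlQ
    have hne0 := mul_ne_zero (mul_ne_zero (hGne ⟨0, hs⟩) (hGne ⟨1, hs2⟩)) hl0
    have hF0 := ne_zero_of_dvd_ne_zero hne0 h
    have hle := totalDegree_le_of_dvd_of_isDomain h hne0
    rw [hF.totalDegree hF0, (hGh hl).totalDegree hne0] at hle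
    exact ⟨hF0, hle⟩
  have hdα : d ≤ α + 1 := degree_le_of_forall_dvd hv0 hα2 hcard hd hF
    fun f hf hfm => hdvd _ (by omega) f hf hfm
  obtain ⟨r, L, hr, hL0, hL, hLind, hprod⟩ := exists_lines hF hF0
    (fun a ha haF => isHomogeneous_one_of_irreducible_factor hv0 hs hF hF0 hFs (by omega) hdvd
      hG0 hGF ha haF)
    (fun a ha ha1 => not_sq_dvd hv0 hα2 hmin hF hF0 hFs (by omega) hdvd hG hG0 hGv hGF ha ha1)
  have hrs : r.choose 2 ≤ s := hcard ▸ Nat.choose_le_choose 2 (hr.trans hdα)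
  exact ⟨r, L, hL, star_of_lines hv0 hvind hL0 hL hLind hrs (Ideal.mem_of_dvd _ hprod hFs)⟩
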